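/- arXiv:2002.10029 — 3 statements merged into one kernel-verified Lean document; each statement's English description precedes it below -/
import Mathlib

section
/- Let D be a finite set of entities and R a finite set of relation symbols, let d ≥ 1, and for each i ∈ {1,…,d} let (pE_i : D → [0,1], pT_i : R → [0,1]) be a single-component TractOR model. Fix entities h, t ∈ D with h ≠ t and a relation symbol R₀ ∈ R. Then the d-dimensional TractOR probability of the triple R₀(h,t), namely (1/d) · Σ_{i=1}^d P_i({ω | ω(E h) ∧ ω(T R₀) ∧ ω(E t)}), equals (1/d) · Σ_{i=1}^d pE_i(h) · pT_i(R₀) · pE_i(t); that is, writing v_h = (pE_1(h),…,pE_d(h)), v_{R₀} = (pT_1(R₀),…,pT_d(R₀)), v_t = (pE_1(t),…,pE_d(t)) ∈ ℝ^d, it equals 1/d times the DistMult trilinear score ⟨v_h, v_{R₀}, v_t⟩ = Σ_{i=1}^d v_h(i) · v_{R₀}(i) · v_t(i). Hence TractOR and DistMult assign identical scores to any triple up to the constant factor 1/d. -/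
open Classical in
/-- The probability of a set `W` of worlds in the tuple-independent probabilistic
database `p : T → [0,1]`. -/
noncomputable def Pr {T : Type*} [Fintype T] [DecidableEq T]
    (p : T → ℝ) (W : Set (T → Bool)) : ℝ :=
  ∑ ω : T → Bool, if ω ∈ W then ∏ t : T, (if ω t then p t else 1 - p t) else 0

/-- The probability that all tuples of a finite set are true is the product of their
parameters. -/
theorem Pr_forall_mem_eq_true {T : Type*} [Fintype T] [DecidableEq T]
    (p : T → ℝ) (S : Finset T) :
    Pr p {ω | ∀ s ∈ S, ω s = true} = ∏ s ∈ S, p s := by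
  have hfactor : ∀ ω : T → Bool,
      (if ω ∈ {ω : T → Bool | ∀ s ∈ S, ω s = true} then
        ∏ t : T, (if ω t then p t else 1 - p t) else 0) =
      ∏ t : T, (if ω t then p t else if t ∈ S then 0 else 1 - p t) := by
    intro ω
    split_ifs with hω
    · refine Finset.prod_congr rfl fun t _ => ?_
      by_cases ht : t ∈ S
      · simp [hω t ht]
      · simp [ht]
    · simp only [Set.mem_ofPred_eq, not_forall] at hω
      obtain ⟨s, hs, hsω⟩ := hω
      exact (Finset.prod_eq_zero (Finset.mem_univ s) (by simp [hs, hsω])).symm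
  have hswap := Fintype.prod_sum
    (fun (t : T) (b : Bool) => if b then p t else if t ∈ S then 0 else 1 - p t)
  unfold Pr
  calc _ = ∑ ω : T → Bool, ∏ t : T, (if ω t then p t else if t ∈ S then 0 else 1 - p t) :=
        Finset.sum_congr rfl fun ω _ => by rw [← hfactor ω]; congr
    _ = ∏ t : T, (if t ∈ S then p t else 1) := by
        rw [← hswap]
        refine Finset.prod_congr rfl fun t _ => ?_
        by_cases ht : t ∈ S <;> simp [ht]
    _ = ∏ s ∈ S, p s := by simp

/-- A `d`-dimensional TractOR model (a uniform mixture of `d` single-component models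
with parameters `pE i : D → [0,1]` on entity tuples `E(c) = Sum.inl c` and
`pT i : R → [0,1]` on relation tuples `T(r) = Sum.inr r`) assigns to a triple
`R₀(h,t)` with `h ≠ t` the probability
`(1/d) · Σ_i pE i h · pT i R₀ · pE i t`, i.e. `1/d` times the DistMult trilinear score
of the embeddings `v_h = (pE i h)_i`, `v_{R₀} = (pT i R₀)_i`, `v_t = (pE i t)_i`.
Hence TractOR and DistMult assign identical scores up to the constant factor `1/d`. -/
theorem tractor_equals_distmult
    {D R : Type*} [Fintype D] [Fintype R] [DecidableEq D] [DecidableEq R]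
    (d : ℕ) (hd : 1 ≤ d)
    (pE : Fin d → D → ℝ) (pT : Fin d → R → ℝ)
    (hE : ∀ (i : Fin d) (c : D), 0 ≤ pE i c ∧ pE i c ≤ 1)
    (hT : ∀ (i : Fin d) (r : R), 0 ≤ pT i r ∧ pT i r ≤ 1)
    (h t : D) (hht : h ≠ t) (R₀ : R) :
    (1 / (d : ℝ)) * ∑ i : Fin d,
        Pr (Sum.elim (pE i) (pT i))
          {ω : D ⊕ R → Bool |
            ω (Sum.inl h) = true ∧ ω (Sum.inr R₀) = true ∧ ω (Sum.inl t) = true} =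
      (1 / (d : ℝ)) * ∑ i : Fin d, pE i h * pT i R₀ * pE i t := by
  congr 1
  refine Finset.sum_congr rfl fun i _ => ?_
  have hset : {ω : D ⊕ R → Bool |
        ω (Sum.inl h) = true ∧ ω (Sum.inr R₀) = true ∧ ω (Sum.inl t) = true} =
      {ω | ∀ s ∈ ({Sum.inl h, Sum.inr R₀, Sum.inl t} : Finset (D ⊕ R)), ω s = true} := by
    ext ω
    simp
  rw [hset, Pr_forall_mem_eq_true, Finset.prod_insert (by simp [hht]),
    Finset.prod_insert (by simp), Finset.prod_singleton]
  simp [mul_assoc]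
end

section
/- Let (pE, pT) be a single-component TractOR model over entities D and relation symbols R. Let A, B, C ∈ D be pairwise distinct entities and R₀, S₀ ∈ R distinct relation symbols. Then the joint probability of the triples R₀(A,B) and S₀(A,C) is P(R₀(A,B) ∧ S₀(A,C)) = pE(A) · pT(R₀) · pE(B) · pT(S₀) · pE(C), whereas the product of their marginal probabilities is pE(A)² · pT(R₀) · pE(B) · pT(S₀) · pE(C). Consequently, if pT(R₀) · pE(B) · pT(S₀) · pE(C) > 0, the events R₀(A,B) and S₀(A,C) are independent if and only if pE(A) = 0 or pE(A) = 1; in particular, triples sharing an entity are in general not independent under the TractOR model. -/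
/-- The event corresponding to the ground atom `R(x,y)` under the single-component
TractOR decomposition `R(x,y) ⇔ E(x) ∧ T(R) ∧ E(y)`, over the tuple set `D ⊕ R` with
entity tuples `E(c) = Sum.inl c` and relation tuples `T(r) = Sum.inr r`. -/
def tripleEvent {D R : Type*} (x : D) (r : R) (y : D) : Set (D ⊕ R → Bool) :=
  {ω | ω (Sum.inl x) = true ∧ ω (Sum.inr r) = true ∧ ω (Sum.inl y) = true}

/-- In a tuple-independent database, the probability that all tuples of a finite set hold is
the product of their parameters. -/
theorem Pr_forall_mem_eq_prod {T : Type*} [Fintype T] [DecidableEq T] (p : T → ℝ)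
    (S : Finset T) : Pr p {ω | ∀ t ∈ S, ω t = true} = ∏ t ∈ S, p t := by
  classical
  let f : T → Bool → ℝ := fun t b =>
    if t ∈ S → b = true then (if b then p t else 1 - p t) else 0
  have hf : ∀ ω : T → Bool,
      (if ω ∈ {ω : T → Bool | ∀ t ∈ S, ω t = true} then
        ∏ t : T, (if ω t then p t else 1 - p t) else 0) = ∏ t, f t (ω t) := by
    intro ω
    by_cases h : ∀ t ∈ S, ω t = true
    · rw [if_pos (Set.mem_ofPred.mpr h)]
      exact Finset.prod_congr rfl fun t _ => (if_pos (h t)).symm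
    · rw [if_neg (mt Set.mem_ofPred.mp h)]
      push Not at h
      obtain ⟨t, ht, hω⟩ := h
      exact (Finset.prod_eq_zero (Finset.mem_univ t) (if_neg fun h => hω (h ht))).symm
  calc
    Pr p {ω | ∀ t ∈ S, ω t = true} = ∑ ω : T → Bool, ∏ t, f t (ω t) :=
      Finset.sum_congr rfl fun ω _ => by convert hf ω
    _ = ∏ t, ∑ b, f t b := (Fintype.prod_sum f).symm
    _ = ∏ t, if t ∈ S then p t else 1 := by
      refine Finset.prod_congr rfl fun t _ => ?_
      by_cases ht : t ∈ S <;> simp [f, ht]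
    _ = ∏ t ∈ S, p t := by simp

theorem Pr_tripleEvent {D R : Type*} [Fintype D] [Fintype R] [DecidableEq D] [DecidableEq R]
    (pE : D → ℝ) (pT : R → ℝ) {x y : D} (hxy : x ≠ y) (r : R) :
    Pr (Sum.elim pE pT) (tripleEvent x r y) = pE x * pT r * pE y := by
  have hS : tripleEvent x r y =
      {ω | ∀ t ∈ ({Sum.inl x, Sum.inr r, Sum.inl y} : Finset (D ⊕ R)), ω t = true} := by
    ext ω
    simp [tripleEvent]
  rw [hS, Pr_forall_mem_eq_prod]
  simp [hxy, mul_assoc]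

theorem Pr_tripleEvent_inter {D R : Type*} [Fintype D] [Fintype R] [DecidableEq D]
    [DecidableEq R] (pE : D → ℝ) (pT : R → ℝ) {x y z : D} (hxy : x ≠ y) (hxz : x ≠ z)
    (hyz : y ≠ z) {r s : R} (hrs : r ≠ s) :
    Pr (Sum.elim pE pT) (tripleEvent x r y ∩ tripleEvent x s z) =
      pE x * pT r * pE y * pT s * pE z := by
  have hS : tripleEvent x r y ∩ tripleEvent x s z =
      {ω | ∀ t ∈ ({Sum.inl x, Sum.inr r, Sum.inl y, Sum.inr s, Sum.inl z} : Finset (D ⊕ R)),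
        ω t = true} := by
    ext ω
    simp only [tripleEvent, Set.mem_inter_iff, Set.mem_ofPred_eq, Finset.mem_insert,
      Finset.mem_singleton, forall_eq_or_imp, forall_eq]
    tauto
  rw [hS, Pr_forall_mem_eq_prod]
  simp [hxy, hxz, hyz, hrs, mul_assoc]

/-- In a single-component TractOR model, for pairwise distinct entities `A, B, C` and
distinct relations `R₀, S₀`: the joint probability of `R₀(A,B)` and `S₀(A,C)` is
`pE A · pT R₀ · pE B · pT S₀ · pE C`, the product of the marginals is
`pE A ² · pT R₀ · pE B · pT S₀ · pE C`, and consequently, when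
`pT R₀ · pE B · pT S₀ · pE C > 0`, the two events are independent iff `pE A = 0` or
`pE A = 1`; triples sharing an entity are in general not independent. -/
theorem tractor_shared_entity_dependence
    {D R : Type*} [Fintype D] [Fintype R] [DecidableEq D] [DecidableEq R]
    (pE : D → ℝ) (pT : R → ℝ)
    (hE : ∀ c : D, 0 ≤ pE c ∧ pE c ≤ 1) (hT : ∀ r : R, 0 ≤ pT r ∧ pT r ≤ 1)
    (A B C : D) (hAB : A ≠ B) (hAC : A ≠ C) (hBC : B ≠ C)
    (R₀ S₀ : R) (hRS : R₀ ≠ S₀) :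
    Pr (Sum.elim pE pT) (tripleEvent A R₀ B ∩ tripleEvent A S₀ C) =
        pE A * pT R₀ * pE B * pT S₀ * pE C ∧
    Pr (Sum.elim pE pT) (tripleEvent A R₀ B) * Pr (Sum.elim pE pT) (tripleEvent A S₀ C) =
        pE A ^ 2 * pT R₀ * pE B * pT S₀ * pE C ∧
    (pT R₀ * pE B * pT S₀ * pE C > 0 →
      (Pr (Sum.elim pE pT) (tripleEvent A R₀ B ∩ tripleEvent A S₀ C) =
          Pr (Sum.elim pE pT) (tripleEvent A R₀ B) *
            Pr (Sum.elim pE pT) (tripleEvent A S₀ C) ↔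
        pE A = 0 ∨ pE A = 1)) := by
  rw [Pr_tripleEvent_inter pE pT hAB hAC hBC hRS, Pr_tripleEvent pE pT hAB,
    Pr_tripleEvent pE pT hAC]
  refine ⟨rfl, by ring, fun hpos => ?_⟩
  have hfactor : pE A * pT R₀ * pE B * pT S₀ * pE C -
      pE A * pT R₀ * pE B * (pE A * pT S₀ * pE C) =
        (pT R₀ * pE B * pT S₀ * pE C) * (pE A * (1 - pE A)) := by ring
  rw [← sub_eq_zero, hfactor, mul_eq_zero_iff_left hpos.ne', mul_eq_zero, sub_eq_zero,
    eq_comm (a := (1 : ℝ))]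
end

section
/- Let (pE, pT) be a single-component TractOR model over entities D and relation symbols R. Let Q = ∃x₁,…,x_k. ⋀_{j=1}^m R_j(x_{a_j}, x_{b_j}) be any Boolean conjunctive query over binary relations with k ≥ 1 existentially quantified variables, m ≥ 1 atoms, and no constants (each argument x_{a_j}, x_{b_j} is one of the quantified variables). Interpreting each atom via the TractOR decomposition R(x,y) ⇔ E(x) ∧ T(R) ∧ E(y), the event defined by Q equals {ω | (⋀ over the set of relation symbols R appearing among R_1,…,R_m of ω(T R)) ∧ (∃ c ∈ D, ω(E c))}, and therefore P(Q) = (∏ over the set of distinct relation symbols R appearing in Q of pT(R)) · (1 − ∏_{c ∈ D} (1 − pE(c))). In particular every such conjunctive query is computable in time linear in |D| under the TractOR model. -/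
/-- A box of worlds has as probability the product of its marginal probabilities. -/
theorem Pr_box {T : Type*} [Fintype T] [DecidableEq T] (p : T → ℝ) (S : T → Finset Bool) :
    Pr p {ω | ∀ t, ω t ∈ S t} = ∏ t, ∑ v ∈ S t, (if v then p t else 1 - p t) := by
  rw [Finset.prod_univ_sum, Pr, ← Finset.sum_subset (Finset.subset_univ (Fintype.piFinset S))]
  · exact Finset.sum_congr rfl fun ω hω => if_pos (Fintype.mem_piFinset.mp hω)
  · exact fun ω _ hω => if_neg fun h => hω (Fintype.mem_piFinset.mpr h)

theorem Pr_diff {T : Type*} [Fintype T] [DecidableEq T] (p : T → ℝ) {A B : Set (T → Bool)}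
    (h : B ⊆ A) : Pr p (A \ B) = Pr p A - Pr p B := by
  rw [Pr, Pr, Pr, ← Finset.sum_sub_distrib]
  refine Finset.sum_congr rfl fun ω _ => ?_
  by_cases hB : ω ∈ B
  · simp [hB, h hB]
  · by_cases hA : ω ∈ A <;> simp [hA, hB]

/-- Since a single present entity can witness all variables at once, a conjunctive query holds
exactly when its relation symbols and at least one entity are present. -/
theorem conjunctive_query_event_eq {D R : Type*} [DecidableEq R] {k m : ℕ} (hm : 1 ≤ m)
    (Rel : Fin m → R) (a b : Fin m → Fin k) :
    {ω : D ⊕ R → Bool | ∃ x : Fin k → D, ∀ j : Fin m,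
        ω (Sum.inl (x (a j))) = true ∧ ω (Sum.inr (Rel j)) = true ∧
        ω (Sum.inl (x (b j))) = true} =
      {ω : D ⊕ R → Bool |
        (∀ r ∈ Finset.image Rel Finset.univ, ω (Sum.inr r) = true) ∧
        ∃ c : D, ω (Sum.inl c) = true} := by
  ext ω
  simp only [Set.mem_ofPred_eq, Finset.mem_image, Finset.mem_univ, true_and,
    forall_exists_index, forall_apply_eq_imp_iff]
  constructor
  · rintro ⟨x, hx⟩
    exact ⟨fun j => (hx j).2.1, x (a ⟨0, hm⟩), (hx ⟨0, hm⟩).1⟩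
  · rintro ⟨hr, c, hc⟩
    exact ⟨fun _ => c, fun j => ⟨hc, hr j, hc⟩⟩

theorem Pr_forall_rel_and_exists_entity {D R : Type*} [Fintype D] [Fintype R] [DecidableEq D]
    [DecidableEq R] (pE : D → ℝ) (pT : R → ℝ) (s : Finset R) :
    Pr (Sum.elim pE pT) {ω : D ⊕ R → Bool |
        (∀ r ∈ s, ω (Sum.inr r) = true) ∧ ∃ c : D, ω (Sum.inl c) = true} =
      (∏ r ∈ s, pT r) * (1 - ∏ c : D, (1 - pE c)) := by
  let rel : R → Finset Bool := fun r => if r ∈ s then {true} else Finset.univ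
  let A : Set (D ⊕ R → Bool) := {ω | ∀ t, ω t ∈ Sum.elim (fun _ => Finset.univ) rel t}
  let B : Set (D ⊕ R → Bool) := {ω | ∀ t, ω t ∈ Sum.elim (fun _ => {false}) rel t}
  have mem_rel (r : R) (v : Bool) : v ∈ rel r ↔ (r ∈ s → v = true) := by
    by_cases hr : r ∈ s <;> simp [rel, hr]
  have event_eq : {ω : D ⊕ R → Bool | (∀ r ∈ s, ω (Sum.inr r) = true) ∧
      ∃ c : D, ω (Sum.inl c) = true} = A \ B := by
    ext ω
    simp only [A, B, Set.mem_sdiff, Set.mem_ofPred_eq, Sum.forall, Sum.elim_inl, Sum.elim_inr,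
      Finset.mem_univ, Finset.mem_singleton, mem_rel, implies_true, true_and, not_and]
    refine and_congr_right fun hr => ?_
    rw [← not_iff_not]
    simpa using fun _ => hr
  have hBA : B ⊆ A := fun ω hω t => by
    cases t with
    | inl c => simp
    | inr r => exact hω (Sum.inr r)
  have prod_rel : ∏ r, ∑ v ∈ rel r, (if v then pT r else 1 - pT r) = ∏ r ∈ s, pT r := by
    rw [← Finset.prod_subset (Finset.subset_univ s)]
    · exact Finset.prod_congr rfl fun r hr => by simp [rel, hr]
    · intro r _ hr
      simp [rel, hr]
  rw [event_eq, Pr_diff _ hBA, Pr_box, Pr_box, Fintype.prod_sum_type, Fintype.prod_sum_type]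
  simp only [Sum.elim_inl, Sum.elim_inr, prod_rel]
  simp
  ring

/-- Under a single-component TractOR model (entity tuples `E(c) = Sum.inl c` with
parameters `pE`, relation tuples `T(r) = Sum.inr r` with parameters `pT`), any Boolean
conjunctive query `Q = ∃x₁,…,x_k. ⋀_{j=1}^m Rel j (x_{a j}, x_{b j})` over binary
relations with `k ≥ 1` variables, `m ≥ 1` atoms and no constants — interpreted via the
TractOR decomposition `R(x,y) ⇔ E(x) ∧ T(R) ∧ E(y)` — defines the event
`{ω | (⋀_{r ∈ image Rel} ω(T r)) ∧ ∃ c ∈ D, ω(E c)}`, and therefore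
`P(Q) = (∏_{r ∈ image Rel} pT r) · (1 - ∏_{c ∈ D} (1 - pE c))`.  In particular every
such conjunctive query is computable in time linear in `|D|` under TractOR. -/
theorem tractor_conjunctive_query_closed_form
    {D R : Type*} [Fintype D] [Fintype R] [DecidableEq D] [DecidableEq R]
    (pE : D → ℝ) (pT : R → ℝ)
    (hE : ∀ c : D, 0 ≤ pE c ∧ pE c ≤ 1) (hT : ∀ r : R, 0 ≤ pT r ∧ pT r ≤ 1)
    (k m : ℕ) (hk : 1 ≤ k) (hm : 1 ≤ m)
    (Rel : Fin m → R) (a b : Fin m → Fin k) :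
    ({ω : D ⊕ R → Bool | ∃ x : Fin k → D, ∀ j : Fin m,
        ω (Sum.inl (x (a j))) = true ∧ ω (Sum.inr (Rel j)) = true ∧
        ω (Sum.inl (x (b j))) = true} =
      {ω : D ⊕ R → Bool |
        (∀ r ∈ Finset.image Rel Finset.univ, ω (Sum.inr r) = true) ∧
        ∃ c : D, ω (Sum.inl c) = true}) ∧
    Pr (Sum.elim pE pT)
        {ω : D ⊕ R → Bool | ∃ x : Fin k → D, ∀ j : Fin m,
          ω (Sum.inl (x (a j))) = true ∧ ω (Sum.inr (Rel j)) = true ∧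
          ω (Sum.inl (x (b j))) = true} =
      (∏ r ∈ Finset.image Rel Finset.univ, pT r) * (1 - ∏ c : D, (1 - pE c)) := by
  have event_eq := conjunctive_query_event_eq (D := D) hm Rel a b
  exact ⟨event_eq, event_eq ▸ Pr_forall_rel_and_exists_entity pE pT _⟩
end
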